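/- arXiv:2009.13710 — 2 statements merged into one kernel-verified Lean document; each statement's English description precedes it below -/
import Mathlib

section
/- Let ℓ ≥ 2, m ≥ 1, k ≥ 0 and 1 ≤ j ≤ ℓ be integers, and let P_1,…,P_ℓ ∈ ℂ[x_1,…,x_ℓ] be defined by g(t) = t^ℓ + P_1 t^{ℓ-1} + ⋯ + P_ℓ. If D is any ℂ-linear derivation of the field ℂ(x_1,…,x_ℓ) satisfying D(P_i) = 1 if i = j and D(P_i) = 0 if i ≠ j, then applying D to each coefficient of η_k^m yields m · η_{k+ℓ−j}^{m−1}; that is, for every 1 ≤ i ≤ ℓ, D(Σ_{j'=1}^ℓ ∫_{x_i}^{x_{j'}} t^k g(t)^m dt) = m · Σ_{j'=1}^ℓ ∫_{x_i}^{x_{j'}} t^{k+ℓ−j} g(t)^{m−1} dt. -/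
open MvPolynomial Polynomial

noncomputable section

abbrev S (ℓ : ℕ) := MvPolynomial (Fin ℓ) ℂ

def defInt {A : Type*} [CommRing A] [Algebra ℚ A] (a b : A) (h : Polynomial A) : A :=
  h.sum fun n c => (((n : ℚ) + 1)⁻¹ • c) * (b ^ (n + 1) - a ^ (n + 1))

def gpoly (ℓ : ℕ) : Polynomial (S ℓ) :=
  ∏ p : Fin ℓ, (Polynomial.X - Polynomial.C (MvPolynomial.X p))

def eta (ℓ k m : ℕ) : Fin ℓ → S ℓ := fun i =>
  ∑ j : Fin ℓ, defInt (MvPolynomial.X i) (MvPolynomial.X j)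
    (Polynomial.X ^ k * gpoly ℓ ^ m)

theorem defInt_monomial {A : Type*} [CommRing A] [Algebra ℚ A] (a b : A) (n : ℕ) (c : A) :
    defInt a b (Polynomial.monomial n c) =
      (((n : ℚ) + 1)⁻¹ • c) * (b ^ (n + 1) - a ^ (n + 1)) := by
  unfold defInt
  rw [Polynomial.sum_monomial_index]
  simp

theorem defInt_add {A : Type*} [CommRing A] [Algebra ℚ A] (a b : A) (p q : Polynomial A) :
    defInt a b (p + q) = defInt a b p + defInt a b q := by
  unfold defInt
  rw [Polynomial.sum_add_index]
  · intro i
    simp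
  · intro i c d
    rw [smul_add, add_mul]

theorem defInt_C_mul {A : Type*} [CommRing A] [Algebra ℚ A] (a b r : A) (p : Polynomial A) :
    defInt a b (Polynomial.C r * p) = r * defInt a b p := by
  induction p using Polynomial.induction_on' with
  | add p q hp hq => rw [mul_add, defInt_add, defInt_add, hp, hq, mul_add]
  | monomial n c =>
    rw [Polynomial.C_mul_monomial, defInt_monomial, defInt_monomial, ← mul_smul_comm, mul_assoc]

theorem map_defInt {A B : Type*} [CommRing A] [Algebra ℚ A] [CommRing B] [Algebra ℚ B]
    (f : A →+* B) (a b : A) (p : Polynomial A) :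
    f (defInt a b p) = defInt (f a) (f b) (p.map f) := by
  induction p using Polynomial.induction_on' with
  | add p q hp hq => rw [Polynomial.map_add, defInt_add, defInt_add, map_add, hp, hq]
  | monomial n c =>
    rw [Polynomial.map_monomial, defInt_monomial, defInt_monomial, map_mul, map_rat_smul]
    simp

open scoped Differential in
/-- Leibniz's rule for differentiating a definite integral whose bounds vary. -/
theorem deriv_defInt {A : Type*} [CommRing A] [Algebra ℚ A] [Differential A]
    (a b : A) (p : Polynomial A) :
    (defInt a b p)′ =
      p.eval b * b′ - p.eval a * a′ + defInt a b (Differential.mapCoeffs p) := by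
  induction p using Polynomial.induction_on' with
  | add p q hp hq =>
    rw [map_add, defInt_add, defInt_add, map_add, hp, hq, Polynomial.eval_add, Polynomial.eval_add]
    ring
  | monomial n c =>
    have hn : algebraMap ℚ A ((n : ℚ) + 1)⁻¹ * ((n : A) + 1) = 1 := by
      have h : ((n : A) + 1) = algebraMap ℚ A ((n : ℚ) + 1) := by simp
      rw [h, ← map_mul, inv_mul_cancel₀ (by positivity), map_one]
    have hc : (((n : ℚ) + 1)⁻¹ • c)′ = ((n : ℚ) + 1)⁻¹ • c′ := map_rat_smul _ _ _
    rw [Differential.mapCoeffs_monomial, defInt_monomial, defInt_monomial, Derivation.leibniz, hc,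
      map_sub, Derivation.leibniz_pow, Derivation.leibniz_pow]
    simp only [Polynomial.eval_monomial, Algebra.smul_def, Algebra.algebraMap_self_apply,
      Nat.add_sub_cancel]
    push_cast
    linear_combination (c * b ^ n * b′ - c * a ^ n * a′) * hn

/-- The differential ring structure on `A` given by a derivation over an arbitrary base ring. -/
abbrev Derivation.toDifferential {R A : Type*} [CommRing R] [CommRing A] [Algebra R A]
    (D : Derivation R A A) : Differential A :=
  ⟨D.restrictScalars ℤ⟩

theorem gpoly_monic (ℓ : ℕ) : (gpoly ℓ).Monic :=
  Polynomial.monic_prod_of_monic _ _ fun _ _ => Polynomial.monic_X_sub_C _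

theorem gpoly_natDegree (ℓ : ℕ) : (gpoly ℓ).natDegree = ℓ := by
  simp [gpoly]

theorem gpoly_eval_X (ℓ : ℕ) (i : Fin ℓ) : (gpoly ℓ).eval (MvPolynomial.X i) = 0 := by
  rw [gpoly, Polynomial.eval_prod]
  exact Finset.prod_eq_zero (Finset.mem_univ i) (by simp)

open scoped Differential in
theorem deriv_map_eta {K : Type*} [CommRing K] [Algebra ℚ K] [Differential K] {ℓ m j : ℕ} (k : ℕ)
    (φ : S ℓ →+* K) (hm : 1 ≤ m) (hj1 : 1 ≤ j) (hjℓ : j ≤ ℓ)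
    (hD : ∀ i : ℕ, 1 ≤ i → i ≤ ℓ → (φ ((gpoly ℓ).coeff (ℓ - i)))′ = if i = j then 1 else 0)
    (i : Fin ℓ) :
    (φ (eta ℓ k m i))′ = (m : K) * φ (eta ℓ (k + ℓ - j) (m - 1) i) := by
  have hg : Differential.mapCoeffs ((gpoly ℓ).map φ) = Polynomial.X ^ (ℓ - j) := by
    ext n
    rw [Differential.coeff_mapCoeffs, Polynomial.coeff_map, Polynomial.coeff_X_pow]
    rcases lt_trichotomy n ℓ with hn | rfl | hn
    · have h := hD (ℓ - n) (by omega) (by omega)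
      rw [show ℓ - (ℓ - n) = n by omega] at h
      rw [h]
      congr 1
      apply propext
      omega
    · have h : (gpoly n).coeff n = 1 := by
        simpa [gpoly_natDegree] using (gpoly_monic n).coeff_natDegree
      rw [h, map_one, Derivation.map_one_eq_zero, if_neg (by omega)]
    · rw [Polynomial.coeff_eq_zero_of_natDegree_lt (by rwa [gpoly_natDegree]), map_zero, map_zero,
        if_neg (by omega)]
  have hX : Differential.mapCoeffs (Polynomial.X : Polynomial K) = 0 :=
    Differential.mapCoeffs_X
  have heval (p : Fin ℓ) :
      (Polynomial.X ^ k * (gpoly ℓ).map φ ^ m).eval (φ (MvPolynomial.X p)) = 0 := by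
    rw [Polynomial.eval_mul, Polynomial.eval_pow, Polynomial.eval_pow, Polynomial.eval_map_apply,
      gpoly_eval_X, map_zero, zero_pow (by omega), mul_zero]
  have hint : Differential.mapCoeffs (Polynomial.X ^ k * (gpoly ℓ).map φ ^ m) =
      Polynomial.C (m : K) *
        (Polynomial.X ^ (k + ℓ - j) * (gpoly ℓ).map φ ^ (m - 1)) := by
    rw [Derivation.leibniz, Derivation.leibniz_pow, Derivation.leibniz_pow, hg, hX,
      Nat.add_sub_assoc hjℓ, pow_add]
    simp only [smul_eq_mul, nsmul_eq_mul, map_natCast]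
    ring
  simp only [_root_.eta, map_sum, Finset.mul_sum]
  refine Finset.sum_congr rfl fun p _ => ?_
  rw [map_defInt, map_defInt, deriv_defInt, Polynomial.map_mul, Polynomial.map_pow,
    Polynomial.map_pow, Polynomial.map_X, heval, heval, hint, defInt_C_mul, Polynomial.map_mul,
    Polynomial.map_pow, Polynomial.map_pow, Polynomial.map_X]
  ring

theorem stmt4 (ℓ : ℕ) (hℓ : 2 ≤ ℓ) (m k j : ℕ) (hm : 1 ≤ m)
    (hj1 : 1 ≤ j) (hjℓ : j ≤ ℓ)
    (D : Derivation ℂ (FractionRing (S ℓ)) (FractionRing (S ℓ)))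
    (hD : ∀ i : ℕ, 1 ≤ i → i ≤ ℓ →
      D (algebraMap (S ℓ) (FractionRing (S ℓ)) ((gpoly ℓ).coeff (ℓ - i))) =
        if i = j then 1 else 0) :
    ∀ i : Fin ℓ,
      D (algebraMap (S ℓ) (FractionRing (S ℓ)) (eta ℓ k m i)) =
        (m : FractionRing (S ℓ)) *
          algebraMap (S ℓ) (FractionRing (S ℓ)) (eta ℓ (k + ℓ - j) (m - 1) i) := by
  intro i
  let _ : Differential (FractionRing (S ℓ)) := D.toDifferential
  exact deriv_map_eta k (algebraMap (S ℓ) (FractionRing (S ℓ))) hm hj1 hjℓ hD i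

end
end

section
/- Let ℓ ≥ 2 and m ≥ 1 be integers. The ℓ vectors θ_0, σ_1^m − σ_2^m, σ_2^m − σ_3^m, …, σ_{ℓ−1}^m − σ_ℓ^m form a basis of the S-module D(B_ℓ, 2m). -/
open MvPolynomial Polynomial

noncomputable section

def gk (ℓ : ℕ) (k : Fin ℓ) : Polynomial (S ℓ) :=
  ∏ p ∈ Finset.univ.erase k, (Polynomial.X - Polynomial.C (MvPolynomial.X p))

def sigmaVF (ℓ m : ℕ) (k : Fin ℓ) : Fin ℓ → S ℓ := fun i =>
  ∑ j : Fin ℓ, defInt (MvPolynomial.X i) (MvPolynomial.X j)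
    (gpoly ℓ ^ (m - 1) * gk ℓ k)

def DB (ℓ m : ℕ) : Submodule (S ℓ) (Fin ℓ → S ℓ) where
  carrier := {f | ∀ i j : Fin ℓ, i < j →
    (MvPolynomial.X i - MvPolynomial.X j) ^ m ∣ f i - f j}
  zero_mem' := by intro i j _; simp
  add_mem' := by
    intro f g hf hg i j hij
    have h := (hf i j hij).add (hg i j hij)
    have : f i - f j + (g i - g j) = (f + g) i - (f + g) j := by
      simp [Pi.add_apply]; ring
    rwa [this] at h
  smul_mem' := by
    intro c f hf i j hij
    have h := (hf i j hij).mul_left c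
    have : c * (f i - f j) = (c • f) i - (c • f) j := by
      simp [Pi.smul_apply, smul_eq_mul]; ring
    rwa [this] at h

/-- The family θ_0, σ_1^m − σ_2^m, …, σ_{ℓ-1}^m − σ_ℓ^m (θ_0 at index 0). -/
def sigmaBasis (ℓ m : ℕ) : Fin ℓ → (Fin ℓ → S ℓ) := fun a =>
  if (a : ℕ) = 0 then (fun _ => 1)
  else sigmaVF ℓ m ⟨(a : ℕ) - 1, Nat.lt_of_le_of_lt (Nat.sub_le _ _) a.isLt⟩
    - sigmaVF ℓ m a

section Integral

variable {A : Type*} [CommRing A] [Algebra ℚ A]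

/-- The formal antiderivative with zero constant term. -/
def antideriv (h : A[X]) : A[X] :=
  h.sum fun n c => Polynomial.monomial (n + 1) (((n : ℚ) + 1)⁻¹ • c)

theorem derivative_antideriv (h : A[X]) : derivative (antideriv h) = h := by
  conv_rhs => rw [← h.sum_monomial_eq]
  rw [antideriv, Polynomial.sum, Polynomial.sum, map_sum]
  refine Finset.sum_congr rfl fun n _ => ?_
  rw [Polynomial.derivative_monomial]
  congr 1
  have hn : ((n : ℚ) + 1) ≠ 0 := by positivity
  have : ((n + 1 : ℕ) : A) = algebraMap ℚ A ((n : ℚ) + 1) := by simp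
  rw [this, mul_comm, ← Algebra.smul_def, smul_smul, mul_inv_cancel₀ hn, one_smul]

theorem defInt_eq_antideriv (a b : A) (h : A[X]) :
    defInt a b h = (antideriv h).eval b - (antideriv h).eval a := by
  simp only [defInt, antideriv, Polynomial.sum, Polynomial.eval_finsetSum,
    Polynomial.eval_monomial, ← Finset.sum_sub_distrib, mul_sub]

variable [IsDomain A]

theorem exists_eq_antideriv_add_C {P h : A[X]} (hP : derivative P = h) :
    ∃ e, P = antideriv h + Polynomial.C e := by
  have : CharZero A := algebraRat.charZero A
  have h0 : derivative (P - antideriv h) = 0 := by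
    rw [Polynomial.derivative_sub, hP, derivative_antideriv, sub_self]
  obtain ⟨e, he⟩ := Polynomial.natDegree_eq_zero.mp
    (Polynomial.derivative_eq_zero.mp h0)
  exact ⟨e, by rw [he]; ring⟩

theorem defInt_eq_of_derivative_eq {P h : A[X]} (hP : derivative P = h) (a b : A) :
    defInt a b h = P.eval b - P.eval a := by
  obtain ⟨e, rfl⟩ := exists_eq_antideriv_add_C hP
  rw [defInt_eq_antideriv]
  simp

theorem pow_dvd_defInt (a b : A) (p q : ℕ) {h : A[X]}
    (hd : (Polynomial.X - Polynomial.C a) ^ p * (Polynomial.X - Polynomial.C b) ^ q ∣ h) :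
    (a - b) ^ (p + q + 1) ∣ defInt a b h := by
  obtain ⟨r, rfl⟩ := hd
  set h := (Polynomial.X - Polynomial.C a) ^ p * (Polynomial.X - Polynomial.C b) ^ q * r with hh
  set L : A[X] := Polynomial.C a + Polynomial.C (b - a) * Polynomial.X with hL
  set s : A[X] := Polynomial.X ^ p * (Polynomial.X - 1) ^ q * r.comp L with hs
  have hG : derivative ((antideriv h).comp L) = Polynomial.C ((b - a) ^ (p + q + 1)) * s := by
    have hL' : derivative L = Polynomial.C (b - a) := by simp [hL]
    have h1 : (Polynomial.X - Polynomial.C a : A[X]).comp L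
        = Polynomial.C (b - a) * Polynomial.X := by simp [hL]
    have h2 : (Polynomial.X - Polynomial.C b : A[X]).comp L
        = Polynomial.C (b - a) * (Polynomial.X - 1) := by simp [hL]; ring
    rw [Polynomial.derivative_comp, derivative_antideriv, hL', hh, Polynomial.mul_comp,
      Polynomial.mul_comp, Polynomial.pow_comp, Polynomial.pow_comp, h1, h2, hs, mul_pow, mul_pow,
      Polynomial.C_pow]
    ring
  have hG' : derivative (Polynomial.C ((b - a) ^ (p + q + 1)) * antideriv s)
      = Polynomial.C ((b - a) ^ (p + q + 1)) * s := by
    rw [Polynomial.derivative_C_mul, derivative_antideriv]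
  have key : defInt a b h = (b - a) ^ (p + q + 1) *
      ((antideriv s).eval 1 - (antideriv s).eval 0) := by
    have e1 := defInt_eq_of_derivative_eq hG 0 1
    have e2 := defInt_eq_of_derivative_eq hG' 0 1
    rw [e2] at e1
    simp only [Polynomial.eval_comp, Polynomial.eval_mul, Polynomial.eval_C, hL,
      Polynomial.eval_add, Polynomial.eval_X, mul_one, mul_zero, add_zero,
      add_sub_cancel] at e1
    rw [defInt_eq_antideriv, ← e1]
    ring
  rw [key, ← neg_sub b a, neg_pow]
  exact Dvd.dvd.mul_right (((isUnit_one.neg.pow _).mul_left_dvd).mpr dvd_rfl) _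

end Integral

theorem le_natDegree_of_pow_dvd_derivative {A ι : Type*} [CommRing A] [IsDomain A] [CharZero A]
    [Fintype ι] (x : ι → A) (hx : Function.Injective x) (n : ℕ) {F : A[X]} (hF : F ≠ 0)
    (hroot : ∀ i, F.IsRoot (x i))
    (hdvd : ∀ i, (Polynomial.X - Polynomial.C (x i)) ^ n ∣ derivative F) :
    Fintype.card ι * (n + 1) ≤ F.natDegree := by
  classical
  have hF' : derivative F ≠ 0 ∨ IsEmpty ι := by
    by_contra! hcon
    obtain ⟨h0, ⟨i⟩⟩ := hcon
    obtain ⟨e, rfl⟩ := Polynomial.natDegree_eq_zero.mp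
      (Polynomial.derivative_eq_zero.mp h0)
    have := hroot i
    simp only [Polynomial.IsRoot, Polynomial.eval_C] at this
    simp [this] at hF
  rcases hF' with hF' | _
  swap
  · simp
  have hmult : ∀ i, n + 1 ≤ F.roots.count (x i) := fun i => by
    rw [Polynomial.count_roots]
    have h1 := (Polynomial.le_rootMultiplicity_iff hF').mpr (hdvd i)
    rw [Polynomial.derivative_rootMultiplicity_of_root (hroot i)] at h1
    have h2 := (Polynomial.rootMultiplicity_pos hF).mpr (hroot i)
    omega
  calc Fintype.card ι * (n + 1) = ∑ _i : ι, (n + 1) := by simp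
    _ ≤ ∑ i, F.roots.count (x i) := Finset.sum_le_sum fun i _ => hmult i
    _ = ∑ a ∈ Finset.univ.image x, F.roots.count a :=
      by rw [Finset.sum_image fun i _ j _ h => hx h]
    _ ≤ ∑ a ∈ Finset.univ.image x ∪ F.roots.toFinset, F.roots.count a :=
      Finset.sum_le_sum_of_subset Finset.subset_union_left
    _ = F.roots.card := Multiset.sum_count_eq_card fun a ha =>
      Finset.mem_union_right _ (Multiset.mem_toFinset.mpr ha)
    _ ≤ F.natDegree := F.card_roots'

section Braid

variable {ℓ : ℕ}

theorem X_sub_C_mul_gk (k : Fin ℓ) :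
    (Polynomial.X - Polynomial.C (MvPolynomial.X k)) * gk ℓ k = gpoly ℓ :=
  Finset.mul_prod_erase Finset.univ
    (fun p : Fin ℓ => (Polynomial.X - Polynomial.C (MvPolynomial.X p) : Polynomial (S ℓ)))
    (Finset.mem_univ k)

theorem X_sub_C_dvd_gk {i k : Fin ℓ} (h : i ≠ k) :
    (Polynomial.X - Polynomial.C (MvPolynomial.X i)) ∣ gk ℓ k :=
  Finset.dvd_prod_of_mem _ (by simp [h])

theorem X_sub_C_dvd_gpoly (i : Fin ℓ) :
    (Polynomial.X - Polynomial.C (MvPolynomial.X i)) ∣ gpoly ℓ :=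
  ⟨_, (X_sub_C_mul_gk i).symm⟩

theorem X_sub_C_mul_dvd_gpoly {i j : Fin ℓ} (h : i ≠ j) :
    (Polynomial.X - Polynomial.C (MvPolynomial.X i)) *
      (Polynomial.X - Polynomial.C (MvPolynomial.X j)) ∣ gpoly ℓ := by
  rw [← X_sub_C_mul_gk j, mul_comm]
  exact mul_dvd_mul_left _ (X_sub_C_dvd_gk h)

theorem monic_gpoly : (gpoly ℓ).Monic :=
  Polynomial.monic_prod_of_monic _ _ fun _ _ => Polynomial.monic_X_sub_C _

theorem natDegree_gpoly : (gpoly ℓ).natDegree = ℓ := by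
  rw [gpoly, Polynomial.natDegree_prod_of_monic _ _ fun _ _ => Polynomial.monic_X_sub_C _]
  simp

theorem monic_gk (k : Fin ℓ) : (gk ℓ k).Monic :=
  Polynomial.monic_prod_of_monic _ _ fun _ _ => Polynomial.monic_X_sub_C _

theorem natDegree_gk (k : Fin ℓ) : (gk ℓ k).natDegree = ℓ - 1 := by
  rw [gk, Polynomial.natDegree_prod_of_monic _ _ fun _ _ => Polynomial.monic_X_sub_C _]
  simp

theorem eval_gk_of_ne {i k : Fin ℓ} (h : i ≠ k) : (gk ℓ k).eval (MvPolynomial.X i) = 0 :=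
  Polynomial.dvd_iff_isRoot.mp (X_sub_C_dvd_gk h)

theorem eval_gk_self_ne_zero (k : Fin ℓ) : (gk ℓ k).eval (MvPolynomial.X k) ≠ 0 := by
  rw [gk, Polynomial.eval_prod, Finset.prod_ne_zero_iff]
  intro p hp
  simp only [Polynomial.eval_sub, Polynomial.eval_X, Polynomial.eval_C]
  exact sub_ne_zero.mpr fun h => (Finset.ne_of_mem_erase hp) (MvPolynomial.X_injective h).symm

theorem gk_sub_gk_mem_degreeLT (j k : Fin ℓ) :
    gk ℓ j - gk ℓ k ∈ Polynomial.degreeLT (S ℓ) (ℓ - 1) := by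
  rw [Polynomial.mem_degreeLT]
  have hdeg : ∀ i, (gk ℓ i).degree = ((ℓ - 1 : ℕ) : WithBot ℕ) := fun i => by
    rw [Polynomial.degree_eq_natDegree (monic_gk i).ne_zero, natDegree_gk]
  rw [← hdeg j]
  exact Polynomial.degree_sub_lt_left ((hdeg j).trans (hdeg k).symm) (monic_gk j).ne_zero
    ((monic_gk j).trans (monic_gk k).symm)

theorem sigmaVF_eq (m : ℕ) (k : Fin ℓ) {P : Polynomial (S ℓ)}
    (hP : derivative P = gpoly ℓ ^ (m - 1) * gk ℓ k) (i : Fin ℓ) :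
    sigmaVF ℓ m k i = ∑ j, (P.eval (MvPolynomial.X j) - P.eval (MvPolynomial.X i)) := by
  simp only [sigmaVF, defInt_eq_of_derivative_eq hP]

theorem sigmaVF_mem_DB {m : ℕ} (hm : 1 ≤ m) (k : Fin ℓ) : sigmaVF ℓ m k ∈ DB ℓ (2 * m) := by
  intro i j hij
  obtain ⟨n, rfl⟩ : ∃ n, m = n + 1 := ⟨m - 1, by omega⟩
  have hP := derivative_antideriv (gpoly ℓ ^ (n + 1 - 1) * gk ℓ k)
  have hdiff : sigmaVF ℓ (n + 1) k i - sigmaVF ℓ (n + 1) k j = (ℓ : S ℓ) *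
      defInt (MvPolynomial.X i) (MvPolynomial.X j) (gpoly ℓ ^ (n + 1 - 1) * gk ℓ k) := by
    rw [sigmaVF_eq _ _ hP, sigmaVF_eq _ _ hP, ← Finset.sum_sub_distrib, defInt_eq_antideriv]
    simp [mul_sub]
  rw [hdiff]
  refine Dvd.dvd.mul_left ?_ _
  have hg := pow_dvd_pow_of_dvd (X_sub_C_mul_dvd_gpoly hij.ne) n
  rw [mul_pow] at hg
  by_cases hk : j = k
  · have := pow_dvd_defInt (MvPolynomial.X i) (MvPolynomial.X j) (n + 1) n
      (h := gpoly ℓ ^ (n + 1 - 1) * gk ℓ k) (by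
        rw [pow_succ, mul_right_comm]
        exact mul_dvd_mul hg (X_sub_C_dvd_gk (hk ▸ hij.ne)))
    convert this using 2
    ring
  · have := pow_dvd_defInt (MvPolynomial.X i) (MvPolynomial.X j) n (n + 1)
      (h := gpoly ℓ ^ (n + 1 - 1) * gk ℓ k) (by
        rw [pow_succ, ← mul_assoc]
        exact mul_dvd_mul hg (X_sub_C_dvd_gk hk))
    convert this using 2
    ring

theorem sigmaBasis_mem_DB {m : ℕ} (hm : 1 ≤ m) (a : Fin ℓ) :
    sigmaBasis ℓ m a ∈ DB ℓ (2 * m) := by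
  rw [sigmaBasis]
  split_ifs
  · intro i j _
    simp
  · exact sub_mem (sigmaVF_mem_DB hm _) (sigmaVF_mem_DB hm _)

/-- The difference `g_{a-1} - g_a`, and `0` at index `0`. -/
def gkDiff (ℓ : ℕ) (a : Fin ℓ) : Polynomial (S ℓ) :=
  if (a : ℕ) = 0 then 0
  else gk ℓ ⟨(a : ℕ) - 1, Nat.lt_of_le_of_lt (Nat.sub_le _ _) a.isLt⟩ - gk ℓ a

theorem gkDiff_mem_degreeLT (a : Fin ℓ) :
    gkDiff ℓ a ∈ Polynomial.degreeLT (S ℓ) (ℓ - 1) := by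
  rw [gkDiff]
  split_ifs
  · exact zero_mem _
  · exact gk_sub_gk_mem_degreeLT _ _

theorem sigmaBasis_apply_sub (m : ℕ) (a i j : Fin ℓ) :
    sigmaBasis ℓ m a i - sigmaBasis ℓ m a j = (ℓ : S ℓ) *
      ((antideriv (gpoly ℓ ^ (m - 1) * gkDiff ℓ a)).eval (MvPolynomial.X j) -
        (antideriv (gpoly ℓ ^ (m - 1) * gkDiff ℓ a)).eval (MvPolynomial.X i)) := by
  rw [sigmaBasis, gkDiff]
  split_ifs
  · simp [antideriv]
  · have hP := fun k => derivative_antideriv (gpoly ℓ ^ (m - 1) * gk ℓ k)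
    rw [← defInt_eq_antideriv, defInt_eq_of_derivative_eq (P :=
      antideriv (gpoly ℓ ^ (m - 1) * gk ℓ
        ⟨(a : ℕ) - 1, Nat.lt_of_le_of_lt (Nat.sub_le _ _) a.isLt⟩) -
      antideriv (gpoly ℓ ^ (m - 1) * gk ℓ a))
      (by rw [Polynomial.derivative_sub, hP, hP, mul_sub])]
    simp only [Pi.sub_apply, sigmaVF_eq _ _ (hP _), Finset.sum_sub_distrib, Finset.sum_const,
      Finset.card_univ, Fintype.card_fin, nsmul_eq_mul, Polynomial.eval_sub]
    ring

theorem eq_zero_of_sum_smul_gkDiff_eq_zero (c : Fin ℓ → S ℓ)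
    (h : ∑ a, c a • gkDiff ℓ a = 0) (a : Fin ℓ) (ha : (a : ℕ) ≠ 0) : c a = 0 := by
  suffices H : ∀ n : ℕ, ∀ a : Fin ℓ, (a : ℕ) = n → n ≠ 0 → c a = 0 from H a a rfl ha
  intro n
  induction n using Nat.strong_induction_on with
  | _ n ih =>
    intro a ha hn
    set k : Fin ℓ := ⟨(a : ℕ) - 1, Nat.lt_of_le_of_lt (Nat.sub_le _ _) a.isLt⟩ with hk
    have hkv : (k : ℕ) = a - 1 := rfl
    have h1 := congrArg (Polynomial.eval (MvPolynomial.X k)) h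
    rw [Polynomial.eval_finsetSum, Polynomial.eval_zero, Finset.sum_eq_single a] at h1
    · rw [gkDiff, if_neg (by omega), Polynomial.eval_smul, Polynomial.eval_sub, ← hk,
        eval_gk_of_ne (i := k) (k := a) (by rw [Ne, Fin.ext_iff]; omega), sub_zero,
        smul_eq_mul] at h1
      exact (mul_eq_zero.mp h1).resolve_right (eval_gk_self_ne_zero k)
    · intro b _ hb
      rw [Ne, Fin.ext_iff] at hb
      by_cases hb0 : (b : ℕ) = 0
      · simp [gkDiff, hb0]
      by_cases hba : (b : ℕ) < n
      · rw [ih b hba b rfl hb0, zero_smul, Polynomial.eval_zero]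
      · rw [gkDiff, if_neg hb0, Polynomial.eval_smul, Polynomial.eval_sub,
          eval_gk_of_ne (by rw [Ne, Fin.ext_iff]; simp only [hkv]; omega),
          eval_gk_of_ne (by rw [Ne, Fin.ext_iff]; omega), sub_zero, smul_zero]
    · simp

theorem linearIndependent_sigmaBasis (hℓ : 2 ≤ ℓ) {m : ℕ} (hm : 1 ≤ m) :
    LinearIndependent (S ℓ) (sigmaBasis ℓ m) := by
  obtain ⟨n, rfl⟩ : ∃ n, m = n + 1 := ⟨m - 1, by omega⟩
  rw [Fintype.linearIndependent_iff]
  intro c hc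
  let z : Fin ℓ := ⟨0, by omega⟩
  set h := ∑ a, c a • gkDiff ℓ a with hh
  set P := ∑ a, c a • antideriv (gpoly ℓ ^ n * gkDiff ℓ a) with hP
  have hP' : derivative P = gpoly ℓ ^ n * h := by
    simp only [hP, hh, map_sum, Polynomial.derivative_smul, derivative_antideriv, Finset.mul_sum,
      mul_smul_comm]
  have hroot : ∀ i, P.eval (MvPolynomial.X i) = P.eval (MvPolynomial.X z) := fun i => by
    have h1 : ∑ a, c a * (sigmaBasis ℓ (n + 1) a z - sigmaBasis ℓ (n + 1) a i) = 0 := by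
      have e := fun j => congrFun hc j
      simp only [Finset.sum_apply, Pi.smul_apply, smul_eq_mul, Pi.zero_apply] at e
      simp only [mul_sub, Finset.sum_sub_distrib, e, sub_zero]
    simp only [sigmaBasis_apply_sub, Nat.add_sub_cancel, mul_left_comm (c _) (ℓ : S ℓ)] at h1
    rw [← Finset.mul_sum] at h1
    have h2 := (mul_eq_zero.mp h1).resolve_left (by
      exact Nat.cast_ne_zero.mpr (by omega))
    simp only [mul_sub, Finset.sum_sub_distrib] at h2
    simpa only [hP, Polynomial.eval_finsetSum, Polynomial.eval_smul, smul_eq_mul] using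
      sub_eq_zero.mp h2
  have hh0 : h = 0 := by
    by_contra hne
    set F := P - Polynomial.C (P.eval (MvPolynomial.X z)) with hF
    have hF' : derivative F = gpoly ℓ ^ n * h := by simp [hF, hP']
    have hF0 : F ≠ 0 := by
      intro h0
      rw [h0, Polynomial.derivative_zero] at hF'
      exact mul_ne_zero (pow_ne_zero n monic_gpoly.ne_zero) hne hF'.symm
    have h1 := le_natDegree_of_pow_dvd_derivative (fun i : Fin ℓ => (MvPolynomial.X i : S ℓ))
      MvPolynomial.X_injective n hF0 (fun i => by simp [hF, hroot i])
      (fun i => hF' ▸ Dvd.dvd.mul_right (pow_dvd_pow_of_dvd (X_sub_C_dvd_gpoly i) n) h)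
    have h2 : (derivative F).natDegree = F.natDegree - 1 := Polynomial.natDegree_derivative F
    have h3 : h ∈ Polynomial.degreeLT (S ℓ) (ℓ - 1) :=
      sum_mem fun a _ => Submodule.smul_mem _ _ (gkDiff_mem_degreeLT a)
    rw [Polynomial.mem_degreeLT, ← Polynomial.natDegree_lt_iff_degree_lt hne] at h3
    rw [hF', Polynomial.natDegree_mul (pow_ne_zero n monic_gpoly.ne_zero) hne,
      Polynomial.natDegree_pow, natDegree_gpoly] at h2
    rw [Fintype.card_fin, mul_add, mul_one, mul_comm] at h1
    omega
  have hpos := eq_zero_of_sum_smul_gkDiff_eq_zero c hh0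
  intro a
  by_cases ha : (a : ℕ) = 0
  · have e := congrFun hc z
    rw [Finset.sum_apply, Finset.sum_eq_single a] at e
    · simpa [sigmaBasis, ha] using e
    · intro b _ hb
      rw [hpos b fun hb0 => hb (Fin.ext (hb0.trans ha.symm)), zero_smul, Pi.zero_apply]
    · simp
  · exact hpos a ha

section Degree

variable {σ R : Type*} [CommRing R]

/-- The total degree in all variables, including the polynomial one, is at most `d`. -/
def JointDegreeLE (d : ℕ) (p : Polynomial (MvPolynomial σ R)) : Prop :=
  ∀ n, p.coeff n ≠ 0 → (p.coeff n).totalDegree + n ≤ d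

theorem JointDegreeLE.mul {d e : ℕ} {p q : Polynomial (MvPolynomial σ R)}
    (hp : JointDegreeLE d p) (hq : JointDegreeLE e q) : JointDegreeLE (d + e) (p * q) := by
  intro n hn
  rw [Polynomial.coeff_mul] at hn ⊢
  have hne : ∃ x ∈ Finset.HasAntidiagonal.antidiagonal n, p.coeff x.1 * q.coeff x.2 ≠ 0 :=
    Finset.exists_ne_zero_of_sum_ne_zero hn
  have hb : ∀ x ∈ Finset.HasAntidiagonal.antidiagonal n, p.coeff x.1 * q.coeff x.2 ≠ 0 →
      (p.coeff x.1 * q.coeff x.2).totalDegree + n ≤ d + e := fun x hx hne => by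
    have h1 := hp x.1 (left_ne_zero_of_mul hne)
    have h2 := hq x.2 (right_ne_zero_of_mul hne)
    have h3 := MvPolynomial.totalDegree_mul (p.coeff x.1) (q.coeff x.2)
    have h4 := Finset.HasAntidiagonal.mem_antidiagonal.mp hx
    omega
  have hnle : n ≤ d + e := by
    obtain ⟨x, hx, hx0⟩ := hne
    have := hb x hx hx0
    omega
  have : (∑ x ∈ Finset.HasAntidiagonal.antidiagonal n, p.coeff x.1 * q.coeff x.2).totalDegree
      ≤ d + e - n := by
    refine MvPolynomial.totalDegree_finsetSum_le fun x hx => ?_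
    by_cases h0 : p.coeff x.1 * q.coeff x.2 = 0
    · simp [h0]
    · have := hb x hx h0
      omega
  omega

theorem JointDegreeLE.one : JointDegreeLE 0 (1 : Polynomial (MvPolynomial σ R)) := by
  intro n hn
  rw [Polynomial.coeff_one] at hn ⊢
  split_ifs at hn ⊢ with h
  · simp [h]
  · simp at hn

theorem JointDegreeLE.pow {d : ℕ} {p : Polynomial (MvPolynomial σ R)}
    (hp : JointDegreeLE d p) (n : ℕ) : JointDegreeLE (n * d) (p ^ n) := by
  induction n with
  | zero => simpa using JointDegreeLE.one
  | succ n ih => rw [pow_succ, add_mul, one_mul]; exact ih.mul hp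

theorem JointDegreeLE.X_sub_C (i : σ) :
    JointDegreeLE 1 (Polynomial.X - Polynomial.C (MvPolynomial.X i : MvPolynomial σ R)) := by
  intro n hn
  rcases subsingleton_or_nontrivial R
  · exact absurd (Subsingleton.elim _ _) hn
  rw [Polynomial.coeff_sub, Polynomial.coeff_X, Polynomial.coeff_C] at hn ⊢
  rcases n with _ | _ | n
  · simp [MvPolynomial.totalDegree_neg]
  · simp
  · simp at hn

theorem JointDegreeLE.prod_X_sub_C (s : Finset σ) :
    JointDegreeLE s.card
      (∏ i ∈ s, (Polynomial.X - Polynomial.C (MvPolynomial.X i : MvPolynomial σ R))) := by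
  classical
  induction s using Finset.induction_on with
  | empty => simpa using JointDegreeLE.one
  | insert i s hi ih =>
    rw [Finset.prod_insert hi, Finset.card_insert_of_notMem hi, add_comm]
    exact (JointDegreeLE.X_sub_C i).mul ih

end Degree

theorem totalDegree_defInt_le {d : ℕ} {h : Polynomial (S ℓ)} (hh : JointDegreeLE d h)
    (i j : Fin ℓ) :
    (defInt (MvPolynomial.X i) (MvPolynomial.X j) h).totalDegree ≤ d + 1 := by
  refine MvPolynomial.totalDegree_finsetSum_le fun n hn => ?_
  have h1 := hh n (Polynomial.mem_support_iff.mp hn)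
  have h2 : (((n : ℚ) + 1)⁻¹ • h.coeff n).totalDegree ≤ (h.coeff n).totalDegree :=
    MvPolynomial.totalDegree_smul_le _ _
  have h3 : ((MvPolynomial.X j : S ℓ) ^ (n + 1) - MvPolynomial.X i ^ (n + 1)).totalDegree
      ≤ n + 1 := (MvPolynomial.totalDegree_sub _ _).trans (by simp)
  have h4 := MvPolynomial.totalDegree_mul (((n : ℚ) + 1)⁻¹ • h.coeff n)
    ((MvPolynomial.X j : S ℓ) ^ (n + 1) - MvPolynomial.X i ^ (n + 1))
  exact h4.trans (by omega)

theorem totalDegree_sigmaVF_le {m : ℕ} (hm : 1 ≤ m) (k i : Fin ℓ) :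
    (sigmaVF ℓ m k i).totalDegree ≤ m * ℓ := by
  refine MvPolynomial.totalDegree_finsetSum_le fun j _ => ?_
  have hg : JointDegreeLE ℓ (gpoly ℓ) := by
    simpa [gpoly] using JointDegreeLE.prod_X_sub_C (R := ℂ) (Finset.univ : Finset (Fin ℓ))
  have hk : JointDegreeLE (ℓ - 1) (gk ℓ k) := by
    simpa [gk] using JointDegreeLE.prod_X_sub_C (R := ℂ) ((Finset.univ : Finset (Fin ℓ)).erase k)
  refine (totalDegree_defInt_le ((hg.pow (m - 1)).mul hk) i j).trans ?_
  obtain ⟨n, rfl⟩ : ∃ n, m = n + 1 := ⟨m - 1, by omega⟩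
  have := k.isLt
  rw [add_mul, one_mul, Nat.add_sub_cancel]
  omega

theorem totalDegree_sigmaBasis_le {m : ℕ} (hm : 1 ≤ m) (a i : Fin ℓ) :
    (sigmaBasis ℓ m a i).totalDegree ≤ if (a : ℕ) = 0 then 0 else m * ℓ := by
  rw [sigmaBasis]
  split_ifs
  · simp
  · exact (MvPolynomial.totalDegree_sub _ _).trans
      (max_le (totalDegree_sigmaVF_le hm _ _) (totalDegree_sigmaVF_le hm _ _))

theorem totalDegree_det_le {ι σ R : Type*} [Fintype ι] [DecidableEq ι] [CommRing R]
    (M : Matrix ι ι (MvPolynomial σ R)) (d : ι → ℕ) (hM : ∀ i a, (M i a).totalDegree ≤ d a) :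
    M.det.totalDegree ≤ ∑ a, d a := by
  rw [Matrix.det_apply']
  refine MvPolynomial.totalDegree_finsetSum_le fun π _ => ?_
  have h1 : (((Equiv.Perm.sign π : ℤ) : MvPolynomial σ R)).totalDegree = 0 := by
    rw [← map_intCast (MvPolynomial.C (R := R) (σ := σ)), MvPolynomial.totalDegree_C]
  calc _ ≤ _ := MvPolynomial.totalDegree_mul _ _
    _ ≤ ∑ a, (M (π a) a).totalDegree := by
      rw [h1, zero_add]; exact MvPolynomial.totalDegree_finsetProd _ _
    _ ≤ _ := Finset.sum_le_sum fun a _ => hM _ _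

theorem prime_X_sub_X {i j : Fin ℓ} (h : i ≠ j) :
    Prime (MvPolynomial.X i - MvPolynomial.X j : S ℓ) := by
  rw [← UniqueFactorizationMonoid.irreducible_iff_prime]
  have := MvPolynomial.irreducible_mul_X_add (1 : S ℓ) (-MvPolynomial.X j) i one_ne_zero
    (by simp) (by simpa [MvPolynomial.vars_neg] using h) isRelPrime_one_left
  simpa [sub_eq_add_neg] using this

theorem not_X_sub_X_dvd {i j k l : Fin ℓ} (hij : i < j) (hkl : k < l) (hne : (i, j) ≠ (k, l)) :
    ¬ (MvPolynomial.X i - MvPolynomial.X j : S ℓ) ∣ MvPolynomial.X k - MvPolynomial.X l := by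
  rintro ⟨r, hr⟩
  have key : ∀ q, i ≠ q → j ≠ q → k ≠ q ∧ l ≠ q := fun q hi hj => by
    have := hkl.ne
    have := congrArg (MvPolynomial.eval (fun p => if p = q then (1 : ℂ) else 0)) hr
    simp only [map_sub, MvPolynomial.eval_X, map_mul, hi, hj, if_false, sub_zero, zero_mul] at this
    by_cases h1 : k = q <;> by_cases h2 : l = q <;> simp_all
  by_cases h1 : i = k ∨ j = k
  · by_cases h2 : i = l ∨ j = l
    · simp only [Ne, Prod.mk.injEq] at hne
      omega
    · exact (key l (by tauto) (by tauto)).2 rfl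
  · exact (key k (by tauto) (by tauto)).1 rfl

/-- The pairs of indices `i < j`. -/
def ltPairs (ℓ : ℕ) : Finset (Σ _ : Fin ℓ, Fin ℓ) :=
  Finset.univ.sigma fun i => Finset.Ioi i

theorem mem_ltPairs {p : Σ _ : Fin ℓ, Fin ℓ} : p ∈ ltPairs ℓ ↔ p.1 < p.2 := by
  simp [ltPairs]

theorem card_ltPairs_mul_two : (ltPairs ℓ).card * 2 = ℓ * (ℓ - 1) := by
  rw [← Finset.sum_range_id_mul_two, ltPairs, Finset.card_sigma]
  simp only [Fin.card_Ioi]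
  rw [Fin.sum_univ_eq_sum_range fun i => ℓ - 1 - i, Finset.sum_range_reflect fun i => i]

/-- The defining polynomial of the braid multiarrangement with constant multiplicity `n`. -/
def braidPoly (ℓ n : ℕ) : S ℓ :=
  ∏ p ∈ ltPairs ℓ, (MvPolynomial.X p.1 - MvPolynomial.X p.2) ^ n

theorem braidPoly_ne_zero (n : ℕ) : braidPoly ℓ n ≠ 0 :=
  Finset.prod_ne_zero_iff.mpr fun _ hp =>
    pow_ne_zero _ (prime_X_sub_X (mem_ltPairs.mp hp).ne).ne_zero

theorem totalDegree_braidPoly (n : ℕ) :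
    (braidPoly ℓ n).totalDegree = (ltPairs ℓ).card * n := by
  refine MvPolynomial.IsHomogeneous.totalDegree ?_ (braidPoly_ne_zero n)
  have := MvPolynomial.IsHomogeneous.prod (ltPairs ℓ)
    (fun p => (MvPolynomial.X p.1 - MvPolynomial.X p.2 : S ℓ) ^ n) (fun _ => n) fun p _ => by
      simpa using ((MvPolynomial.isHomogeneous_X ℂ p.1).sub
        (MvPolynomial.isHomogeneous_X ℂ p.2)).pow n
  simpa [braidPoly] using this

theorem braidPoly_dvd_det {n : ℕ} (M : Matrix (Fin ℓ) (Fin ℓ) (S ℓ))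
    (hM : ∀ a, (fun i => M i a) ∈ DB ℓ n) : braidPoly ℓ n ∣ M.det := by
  refine Finset.prod_dvd_of_isRelPrime (fun p hp q hq hpq => ?_) fun p hp => ?_
  · have hp' := mem_ltPairs.mp hp
    have hq' := mem_ltPairs.mp hq
    refine IsRelPrime.pow ?_
    refine (prime_X_sub_X hp'.ne).irreducible.isRelPrime_iff_not_dvd.mpr
      (not_X_sub_X_dvd hp' hq' fun h => hpq ?_)
    rw [Prod.mk.injEq] at h
    exact Sigma.ext h.1 (heq_of_eq h.2)
  · have hp' := mem_ltPairs.mp hp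
    rw [← Matrix.det_updateRow_add_smul_self M hp'.ne (-1),
      Matrix.det_eq_sum_mul_adjugate_row _ p.1]
    refine Finset.dvd_sum fun a _ => Dvd.dvd.mul_right ?_ _
    simpa [sub_eq_add_neg] using hM a p.1 p.2 hp'

/-- Saito's criterion for the braid multiarrangement with constant multiplicity `n`. -/
theorem mem_span_range_of_mem_DB {n : ℕ} (b : Fin ℓ → Fin ℓ → S ℓ) (hb : ∀ a, b a ∈ DB ℓ n)
    (hli : LinearIndependent (S ℓ) b) (d : Fin ℓ → ℕ) (hd : ∀ a i, (b a i).totalDegree ≤ d a)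
    (hsum : ∑ a, d a ≤ (ltPairs ℓ).card * n) {v : Fin ℓ → S ℓ} (hv : v ∈ DB ℓ n) :
    v ∈ Submodule.span (S ℓ) (Set.range b) := by
  set M : Matrix (Fin ℓ) (Fin ℓ) (S ℓ) := Matrix.of fun i a => b a i with hM
  have hmul : ∀ c : Fin ℓ → S ℓ, M.mulVec c = ∑ a, c a • b a := fun c => by
    ext1 i
    simp [hM, Matrix.mulVec, dotProduct, Finset.sum_apply, mul_comm]
  have hdet : M.det ≠ 0 := fun h0 => by
    obtain ⟨c, hc, hc0⟩ := Matrix.exists_mulVec_eq_zero_iff.mpr h0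
    rw [hmul] at hc0
    exact hc (funext (Fintype.linearIndependent_iff.mp hli c hc0))
  obtain ⟨r, hr⟩ := braidPoly_dvd_det M hb
  have hr0 : r ≠ 0 := fun h => hdet (by rw [hr, h, mul_zero])
  have hrdeg : r.totalDegree = 0 := by
    have h1 := totalDegree_det_le M d fun i a => hd a i
    rw [hr, MvPolynomial.totalDegree_mul_of_isDomain (braidPoly_ne_zero n) hr0,
      totalDegree_braidPoly] at h1
    omega
  rw [MvPolynomial.totalDegree_eq_zero_iff_eq_C] at hrdeg
  set e := MvPolynomial.coeff 0 r
  have he : e ≠ 0 := fun h => hr0 (by rw [hrdeg, h, MvPolynomial.C_0])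
  have hw : ∀ a, ∃ w, M.cramer v a = braidPoly ℓ n * w := fun a => by
    rw [Matrix.cramer_apply]
    refine braidPoly_dvd_det _ fun a' => ?_
    by_cases h : a' = a
    · subst h
      simpa using hv
    · simpa [hM, Matrix.updateCol_apply, h] using hb a'
  choose w hw using hw
  have hcr : M.cramer v = braidPoly ℓ n • w := funext hw
  have h1 := Matrix.mulVec_cramer M v
  rw [hcr, Matrix.mulVec_smul, hr, mul_smul] at h1
  have h2 : M.mulVec w = r • v := smul_right_injective _ (braidPoly_ne_zero n) h1
  have h3 : v = (MvPolynomial.C e⁻¹ : S ℓ) • M.mulVec w := by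
    rw [h2, smul_smul, hrdeg, ← MvPolynomial.C_mul, inv_mul_cancel₀ he, MvPolynomial.C_1, one_smul]
  rw [h3, hmul]
  exact Submodule.smul_mem _ _ (sum_mem fun a _ =>
    Submodule.smul_mem _ _ (Submodule.subset_span ⟨a, rfl⟩))

end Braid

theorem stmt6 (ℓ : ℕ) (hℓ : 2 ≤ ℓ) (m : ℕ) (hm : 1 ≤ m) :
    (∀ a : Fin ℓ, sigmaBasis ℓ m a ∈ DB ℓ (2 * m)) ∧
    LinearIndependent (S ℓ) (sigmaBasis ℓ m) ∧
    (∀ v ∈ DB ℓ (2 * m),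
      v ∈ Submodule.span (S ℓ) (Set.range (sigmaBasis ℓ m))) := by
  refine ⟨sigmaBasis_mem_DB hm, linearIndependent_sigmaBasis hℓ hm, fun v hv =>
    mem_span_range_of_mem_DB _ (sigmaBasis_mem_DB hm) (linearIndependent_sigmaBasis hℓ hm)
      (fun a => if (a : ℕ) = 0 then 0 else m * ℓ) (totalDegree_sigmaBasis_le hm) ?_ hv⟩
  have hcard := card_ltPairs_mul_two (ℓ := ℓ)
  have hle : ∑ a : Fin ℓ, (if (a : ℕ) = 0 then 0 else m * ℓ) = (ℓ - 1) * (m * ℓ) := by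
    obtain ⟨k, rfl⟩ : ∃ k, ℓ = k + 1 := ⟨ℓ - 1, by omega⟩
    simp [Fin.sum_univ_succ]
  rw [hle, ← mul_assoc _ 2 m, hcard]
  exact le_of_eq (by ring)

end
end
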